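/- There is an absolute constant C > 0 with the following property. Let H ≥ 1, let c : ℕ → ℂ be finitely supported, and write S_c(α) := Σ_{n≥1} c(n) e(nα). Let M ⊆ [0,1] be measurable and set m := [0,1] \ M. Suppose B₁, B₂ ≥ 0 are such that for every α ∈ M one has ∫_{β ∈ M, ‖β−α‖ ≤ 1/(2H)} |S_c(β)|² dβ ≤ B₁, and for every α ∈ m one has ∫_{β ∈ m, ‖β−α‖ ≤ 1/(2H)} |S_c(β)|² dβ ≤ B₂. Then Σ_{h∈ℤ, 1≤|h|≤H} | Σ_{n,m'≥1, n−m'=h} c(n) conj(c(m')) |² ≤ C · H · (Σ_{n≥1} |c(n)|²) · (B₁ + B₂). -/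

import Mathlib

open MeasureTheory

/-- `e(x) = e^{2πix}`. -/
noncomputable def e (x : ℝ) : ℂ := Complex.exp (2 * Real.pi * Complex.I * (x : ℂ))

theorem e_add (x y : ℝ) : e (x + y) = e x * e y := by
  simp only [e, ← Complex.exp_add]
  push_cast
  ring_nf

theorem norm_e (x : ℝ) : ‖e x‖ = 1 := by
  have : e x = Complex.exp ((2 * Real.pi * x : ℝ) * Complex.I) := by
    simp only [e]
    push_cast
    ring_nf
  rw [this, Complex.norm_exp_ofReal_mul_I]

theorem conj_e (x : ℝ) : (starRingEnd ℂ) (e x) = e (-x) := by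
  simp [e, ← Complex.exp_conj, Complex.conj_ofNat]

theorem e_int (k : ℤ) : e k = 1 := by
  rw [e, Complex.exp_eq_one_iff]
  exact ⟨k, by push_cast; ring⟩

theorem e_natCast_mul (k : ℕ) (x : ℝ) : e (k * x) = e x ^ k := by
  simp only [e, ← Complex.exp_nat_mul]
  push_cast
  ring_nf

@[fun_prop]
theorem continuous_e : Continuous e := by
  unfold e
  fun_prop

theorem four_mul_abs_sub_round_le_norm_e_sub_one (t : ℝ) :
    4 * |t - round t| ≤ ‖e t - 1‖ := by
  set x := t - round t with hx
  have het : e t = e x := by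
    have : t = x + (round t : ℤ) := by rw [hx]; ring
    rw [this, e_add, e_int, mul_one]
  have hexp : e x = Complex.exp (Complex.I * ((2 * Real.pi * x : ℝ) : ℂ)) := by
    simp only [e]
    push_cast
    ring_nf
  have hsin := Real.mul_abs_le_abs_sin (x := Real.pi * x) (by
    rw [abs_mul, abs_of_pos Real.pi_pos]
    nlinarith [abs_sub_round t, Real.pi_pos])
  rw [abs_mul, abs_of_pos Real.pi_pos] at hsin
  have hpi : 2 / Real.pi * (Real.pi * |x|) = 2 * |x| := by
    field_simp
  rw [het, hexp, Complex.norm_exp_I_mul_ofReal_sub_one, norm_mul, Real.norm_eq_abs,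
    Real.norm_eq_abs, abs_two, show 2 * Real.pi * x / 2 = Real.pi * x by ring]
  linarith

/-- The Dirichlet kernel `∑_{k < N} e(kt)`. -/
noncomputable def dirichletSum (N : ℕ) (t : ℝ) : ℂ := ∑ k ∈ Finset.range N, e (k * t)

@[fun_prop]
theorem continuous_dirichletSum (N : ℕ) : Continuous (dirichletSum N) := by
  unfold dirichletSum
  fun_prop

theorem norm_dirichletSum_le (N : ℕ) (t : ℝ) : ‖dirichletSum N t‖ ≤ N := by
  refine (norm_sum_le _ _).trans ?_
  simp [norm_e]

theorem norm_dirichletSum_mul_abs_sub_round_le (N : ℕ) (t : ℝ) :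
    2 * (‖dirichletSum N t‖ * |t - round t|) ≤ 1 := by
  have hgeom : dirichletSum N t * (e t - 1) = e t ^ N - 1 := by
    simp only [dirichletSum, e_natCast_mul]
    exact geom_sum_mul _ _
  have hnorm : ‖dirichletSum N t‖ * ‖e t - 1‖ ≤ 2 := by
    rw [← norm_mul, hgeom]
    refine (norm_sub_le _ _).trans ?_
    simp only [norm_pow, norm_e, one_pow, norm_one]
    norm_num
  nlinarith [mul_le_mul_of_nonneg_left (four_mul_abs_sub_round_le_norm_e_sub_one t)
    (norm_nonneg (dirichletSum N t))]

theorem norm_dirichletSum_sq_mul_le (N : ℕ) (t d : ℝ) (hd : |N * (t - round t) - d| ≤ 1) :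
    ‖dirichletSum N t‖ ^ 2 * (1 + d ^ 2) ≤ 4 * N ^ 2 := by
  set D := ‖dirichletSum N t‖
  set x := t - round t
  have hN := norm_dirichletSum_le N t
  have hx := norm_dirichletSum_mul_abs_sub_round_le N t
  have hD : 0 ≤ D := norm_nonneg _
  have hDN : D ^ 2 ≤ (N : ℝ) ^ 2 := by gcongr
  have hDx : 4 * (D ^ 2 * x ^ 2) ≤ 1 := by
    have h0 : 0 ≤ D * |x| := by positivity
    rw [← sq_abs x]
    nlinarith
  have hd2 : d ^ 2 ≤ 2 + 2 * (N * x) ^ 2 := by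
    obtain ⟨h1, h2⟩ := abs_le.1 hd
    nlinarith [sq_nonneg (N * x + (N * x - d))]
  have hN2 : (0 : ℝ) ≤ (N : ℝ) ^ 2 := by positivity
  calc D ^ 2 * (1 + d ^ 2) ≤ D ^ 2 * (3 + 2 * (N * x) ^ 2) := 
        mul_le_mul_of_nonneg_left (by linarith) (by positivity)
    _ = 3 * D ^ 2 + 2 * N ^ 2 * (D ^ 2 * x ^ 2) := by ring
    _ ≤ 4 * N ^ 2 := by nlinarith

theorem ofReal_norm_dirichletSum_sq (N : ℕ) (t : ℝ) :
    ((‖dirichletSum N t‖ ^ 2 : ℝ) : ℂ) =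
      ∑ p ∈ Finset.range N ×ˢ Finset.range N, e (((p.1 : ℤ) - (p.2 : ℤ) : ℤ) * t) := by
  rw [← Complex.normSq_eq_norm_sq, ← Complex.mul_conj, dirichletSum, map_sum,
    Finset.sum_mul_sum, ← Finset.sum_product']
  refine Finset.sum_congr rfl fun p _ => ?_
  rw [conj_e, ← e_add]
  push_cast
  ring_nf

theorem summable_one_div_one_add_sq : Summable fun j : ℤ => 1 / (1 + (j : ℝ) ^ 2) := by
  refine Summable.of_norm_bounded_eventually (Real.summable_one_div_int_pow.2 one_lt_two) ?_
  filter_upwards [(Set.finite_singleton (0 : ℤ)).compl_mem_cofinite] with j hj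
  have hj' : (j : ℝ) ≠ 0 := by simpa using hj
  have : 0 < (j : ℝ) ^ 2 := by positivity
  rw [Real.norm_of_nonneg (by positivity)]
  gcongr
  linarith

/-- The total mass `∑_{j ∈ ℤ} 1 / (1 + j²)`. -/
noncomputable def cauchySum : ℝ := ∑' j : ℤ, 1 / (1 + (j : ℝ) ^ 2)

theorem sum_range_one_div_one_add_sq_le (n : ℕ) (r : ℤ) :
    ∑ j ∈ Finset.range n, 1 / (1 + (((j : ℤ) - r : ℤ) : ℝ) ^ 2) ≤ cauchySum := by
  have hinj : Function.Injective fun j : ℕ => (j : ℤ) - r := fun a b h => by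
    simp only at h
    lia
  refine (Finset.sum_map (Finset.range n) ⟨_, hinj⟩
    fun j : ℤ => 1 / (1 + (j : ℝ) ^ 2)).symm.trans_le ?_
  exact summable_one_div_one_add_sq.sum_le_tsum _ fun _ _ => by positivity

theorem cauchySum_pos : 0 < cauchySum :=
  summable_one_div_one_add_sq.tsum_pos (fun _ => by positivity) 0 (by norm_num)

theorem setIntegral_inter_arc_le {E : Set ℝ} (hE : E ⊆ Set.Icc 0 1)
    {f : ℝ → ℝ} (hf : Continuous f) (hf0 : ∀ x, 0 ≤ f x) {δ B : ℝ} (hB : 0 ≤ B)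
    (hloc : ∀ α ∈ E,
      (∫ β in {β : ℝ | β ∈ E ∧ |(β - α) - (round (β - α) : ℝ)| ≤ δ}, f β) ≤ B)
    {N : ℕ} (hN : 0 < N) (hNδ : 1 / (N : ℝ) ≤ δ) (j : ℕ) :
    ∫ β in E ∩ {β : ℝ | (j : ℝ) ≤ N * β ∧ N * β ≤ j + 1}, f β ≤ B := by
  rcases (E ∩ {β : ℝ | (j : ℝ) ≤ N * β ∧ N * β ≤ j + 1}).eq_empty_or_nonempty with h | ⟨α, hα, hα'⟩
  · simpa [h] using hB
  · refine le_trans (setIntegral_mono_set ?_ (ae_of_all _ hf0) (LE.le.eventuallyLE ?_))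
      (hloc α hα)
    · exact hf.integrableOn_Icc.mono_set (fun β hβ => hE hβ.1)
    · rintro β ⟨hβ, hβ'⟩
      refine ⟨hβ, le_trans (round_le (β - α) 0) (le_trans ?_ hNδ)⟩
      have hN' : (0 : ℝ) < N := by exact_mod_cast hN
      simp only [Set.mem_ofPred_eq] at hα' hβ'
      rw [Int.cast_zero, sub_zero, le_div_iff₀ hN', ← abs_of_pos hN', ← abs_mul, abs_le]
      constructor <;> nlinarith

theorem norm_dirichletSum_sq_le_sum (N : ℕ) {α β : ℝ} (hα : α ∈ Set.Icc (0 : ℝ) 1)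
    (hβ : β ∈ Set.Icc (0 : ℝ) 1) :
    ‖dirichletSum N (β - α)‖ ^ 2 ≤ 4 * N ^ 2 * ∑ m ∈ Finset.Icc (-1 : ℤ) 1,
      1 / (1 + (((⌊N * β⌋₊ : ℤ) - (⌊N * α⌋ + N * m) : ℤ) : ℝ) ^ 2) := by
  have hround : round (β - α) ∈ Finset.Icc (-1 : ℤ) 1 := by
    obtain ⟨h1, h2⟩ := abs_le.1 (abs_sub_round (β - α))
    obtain ⟨h3, h4⟩ := hα
    obtain ⟨h5, h6⟩ := hβ
    rw [Finset.mem_Icc]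
    constructor
    · have : ((-2 : ℤ) : ℝ) < round (β - α) := by push_cast; linarith
      have := Int.cast_lt.1 this
      lia
    · have : (round (β - α) : ℝ) < ((2 : ℤ) : ℝ) := by push_cast; linarith
      have := Int.cast_lt.1 this
      lia
  set d : ℝ := (((⌊N * β⌋₊ : ℤ) - (⌊N * α⌋ + N * round (β - α)) : ℤ) : ℝ) with hd
  have hdist : |N * (β - α - round (β - α)) - d| ≤ 1 := by
    have h1 := Nat.floor_le (mul_nonneg (Nat.cast_nonneg (α := ℝ) N) hβ.1)
    have h2 := Nat.lt_floor_add_one (N * β)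
    have h3 := Int.floor_le (N * α)
    have h4 := Int.lt_floor_add_one (N * α)
    rw [hd, abs_le]
    push_cast
    constructor <;> linarith
  have hmain := norm_dirichletSum_sq_mul_le N (β - α) d hdist
  have hpos : 0 < 1 + d ^ 2 := by positivity
  calc ‖dirichletSum N (β - α)‖ ^ 2 ≤ 4 * N ^ 2 * (1 / (1 + d ^ 2)) := by
        rw [mul_one_div, le_div_iff₀ hpos]
        exact hmain
    _ ≤ _ := by
        gcongr
        exact Finset.single_le_sum (f := fun m : ℤ =>
          1 / (1 + (((⌊N * β⌋₊ : ℤ) - (⌊N * α⌋ + N * m) : ℤ) : ℝ) ^ 2))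
          (fun _ _ => by positivity) hround

theorem setIntegral_mul_norm_dirichletSum_sq_le {E : Set ℝ} (hEm : MeasurableSet E)
    (hE : E ⊆ Set.Icc 0 1) {f : ℝ → ℝ} (hf : Continuous f) (hf0 : ∀ x, 0 ≤ f x) {δ B : ℝ}
    (hB : 0 ≤ B)
    (hloc : ∀ α ∈ E,
      (∫ β in {β : ℝ | β ∈ E ∧ |(β - α) - (round (β - α) : ℝ)| ≤ δ}, f β) ≤ B)
    {N : ℕ} (hN : 0 < N) (hNδ : 1 / (N : ℝ) ≤ δ) {α : ℝ} (hα : α ∈ Set.Icc (0 : ℝ) 1) :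
    ∫ β in E, f β * ‖dirichletSum N (β - α)‖ ^ 2 ≤ 12 * N ^ 2 * cauchySum * B := by
  set I : ℕ → Set ℝ := fun j => {β : ℝ | (j : ℝ) ≤ N * β ∧ N * β ≤ j + 1}
  have hIm : ∀ j, MeasurableSet (I j) := fun j =>
    (measurableSet_le (f := fun _ => (j : ℝ)) (g := fun β : ℝ => N * β) (by fun_prop)
      (by fun_prop)).inter (measurableSet_le (f := fun β : ℝ => N * β)
      (g := fun _ => (j : ℝ) + 1) (by fun_prop) (by fun_prop))
  set s : ℕ → ℝ := fun j => 4 * N ^ 2 * ∑ m ∈ Finset.Icc (-1 : ℤ) 1,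
    1 / (1 + (((j : ℤ) - (⌊N * α⌋ + N * m) : ℤ) : ℝ) ^ 2)
  have hs0 : ∀ j, 0 ≤ s j := fun j => by positivity
  have hint : IntegrableOn f E := hf.integrableOn_Icc.mono_set hE
  have hterm : ∀ j, Integrable (fun β => s j * (I j).indicator f β) (volume.restrict E) :=
    fun j => (hint.indicator (hIm j)).const_mul _
  have hpoint : ∀ β ∈ E, f β * ‖dirichletSum N (β - α)‖ ^ 2 ≤
      ∑ j ∈ Finset.range (N + 1), s j * (I j).indicator f β := by
    intro β hβ
    have hNβ : 0 ≤ N * β := mul_nonneg (Nat.cast_nonneg _) (hE hβ).1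
    have hmem : ⌊N * β⌋₊ ∈ Finset.range (N + 1) := by
      rw [Finset.mem_range, Nat.lt_succ_iff]
      exact Nat.floor_le_of_le (mul_le_of_le_one_right (Nat.cast_nonneg _) (hE hβ).2)
    have hβI : β ∈ I ⌊N * β⌋₊ := ⟨Nat.floor_le hNβ, (Nat.lt_floor_add_one _).le⟩
    calc f β * ‖dirichletSum N (β - α)‖ ^ 2 ≤ f β * s ⌊N * β⌋₊ :=
          mul_le_mul_of_nonneg_left (norm_dirichletSum_sq_le_sum N hα (hE hβ)) (hf0 β)
      _ = s ⌊N * β⌋₊ * (I ⌊N * β⌋₊).indicator f β := by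
          rw [Set.indicator_of_mem hβI, mul_comm]
      _ ≤ _ := Finset.single_le_sum (f := fun j => s j * (I j).indicator f β)
          (fun j _ => mul_nonneg (hs0 j) (Set.indicator_nonneg (fun x _ => hf0 x) _)) hmem
  have hsum : ∑ j ∈ Finset.range (N + 1), s j ≤ 12 * N ^ 2 * cauchySum := by
    rw [← Finset.mul_sum, Finset.sum_comm]
    calc _ ≤ 4 * (N : ℝ) ^ 2 * ∑ m ∈ Finset.Icc (-1 : ℤ) 1, cauchySum := by
          gcongr
          exact sum_range_one_div_one_add_sq_le _ _
      _ = _ := by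
          simp
          ring
  calc ∫ β in E, f β * ‖dirichletSum N (β - α)‖ ^ 2
      ≤ ∫ β in E, ∑ j ∈ Finset.range (N + 1), s j * (I j).indicator f β := by
        refine integral_mono_of_nonneg (ae_of_all _ fun β => mul_nonneg (hf0 β) (by positivity))
          (integrable_finsetSum _ fun j _ => hterm j) ?_
        filter_upwards [ae_restrict_mem hEm] with β hβ using hpoint β hβ
    _ = ∑ j ∈ Finset.range (N + 1), s j * ∫ β in E ∩ I j, f β := by
        rw [integral_finsetSum _ fun j _ => hterm j]
        refine Finset.sum_congr rfl fun j _ => ?_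
        rw [integral_const_mul, setIntegral_indicator (hIm j)]
    _ ≤ ∑ j ∈ Finset.range (N + 1), s j * B := by
        gcongr with j
        exact setIntegral_inter_arc_le hE hf hf0 hB hloc hN hNδ j
    _ ≤ _ := by
        rw [← Finset.sum_mul]
        gcongr

/-- The Fourier coefficient `∫_E f(β) e(-hβ) dβ`. -/
noncomputable def setFourierCoeff (E : Set ℝ) (f : ℝ → ℝ) (h : ℤ) : ℂ :=
  ∫ β in E, (f β : ℂ) * e (-(h * β))

theorem sum_norm_setFourierCoeff_sq {E : Set ℝ} (hE : E ⊆ Set.Icc 0 1) {f : ℝ → ℝ}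
    (hf : Continuous f) (N : ℕ) :
    ∑ p ∈ Finset.range N ×ˢ Finset.range N, ‖setFourierCoeff E f ((p.1 : ℤ) - p.2)‖ ^ 2 =
      ∫ α in E, f α * ∫ β in E, f β * ‖dirichletSum N (β - α)‖ ^ 2 := by
  have hint : ∀ g : ℝ → ℂ, Continuous g → Integrable g (volume.restrict E) := fun g hg =>
    hg.integrableOn_Icc.mono_set hE
  have hinner : ∀ α : ℝ, ((∫ β in E, f β * ‖dirichletSum N (β - α)‖ ^ 2 : ℝ) : ℂ) =
      ∑ p ∈ Finset.range N ×ˢ Finset.range N,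
        e (-(((p.1 : ℤ) - (p.2 : ℤ) : ℤ) * α)) *
          (starRingEnd ℂ) (setFourierCoeff E f ((p.1 : ℤ) - p.2)) := by
    intro α
    rw [← integral_complex_ofReal]
    simp only [Complex.ofReal_mul, ofReal_norm_dirichletSum_sq, Finset.mul_sum]
    rw [integral_finsetSum _ fun p _ => hint _ (by fun_prop)]
    refine Finset.sum_congr rfl fun p _ => ?_
    rw [setFourierCoeff, ← integral_conj, ← integral_const_mul]
    congr 1
    ext β
    rw [map_mul, Complex.conj_ofReal, conj_e, mul_left_comm, ← e_add]
    ring_nf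
  apply Complex.ofReal_injective
  rw [← integral_complex_ofReal]
  simp only [Complex.ofReal_mul, hinner, Finset.mul_sum]
  rw [integral_finsetSum _ fun p _ => hint _ (by fun_prop)]
  rw [Complex.ofReal_sum]
  refine Finset.sum_congr rfl fun p _ => ?_
  simp only [← mul_assoc]
  rw [integral_mul_const, ← setFourierCoeff, Complex.mul_conj, Complex.normSq_eq_norm_sq]

theorem mul_sum_Icc_le_sum_range_product {F : ℤ → ℝ} (hF : ∀ h, 0 ≤ F h) (K : ℕ) :
    ((K + 1 : ℕ) : ℝ) * ∑ h ∈ Finset.Icc (-(K : ℤ)) K, F h ≤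
      ∑ p ∈ Finset.range (2 * (K + 1)) ×ˢ Finset.range (2 * (K + 1)), F ((p.1 : ℤ) - p.2) := by
  set i : ℤ × ℕ → ℕ × ℕ := fun q => (q.2 + q.1.toNat, q.2 + (-q.1).toNat) with hi
  have hinj : Set.InjOn i ↑(Finset.Icc (-(K : ℤ)) K ×ˢ Finset.range (K + 1)) := by
    rintro ⟨h, l⟩ - ⟨h', l'⟩ - heq
    simp only [hi, Prod.mk.injEq] at heq ⊢
    lia
  calc ((K + 1 : ℕ) : ℝ) * ∑ h ∈ Finset.Icc (-(K : ℤ)) K, F h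
      = ∑ q ∈ Finset.Icc (-(K : ℤ)) K ×ˢ Finset.range (K + 1), F (((i q).1 : ℤ) - (i q).2) := by
        rw [Finset.sum_product, Finset.mul_sum]
        refine Finset.sum_congr rfl fun h _ => ?_
        have : ∀ l : ℕ, ((i (h, l)).1 : ℤ) - (i (h, l)).2 = h := fun l => by
          simp only [hi]
          lia
        simp [this]
    _ = ∑ p ∈ (Finset.Icc (-(K : ℤ)) K ×ˢ Finset.range (K + 1)).image i,
          F ((p.1 : ℤ) - p.2) := (Finset.sum_image hinj (f := fun p => F ((p.1 : ℤ) - p.2))).symm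
    _ ≤ _ := by
        refine Finset.sum_le_sum_of_subset_of_nonneg ?_ fun _ _ _ => hF _
        intro p hp
        obtain ⟨⟨h, l⟩, hq, rfl⟩ := Finset.mem_image.1 hp
        simp only [Finset.mem_product, Finset.mem_Icc, Finset.mem_range, hi] at hq ⊢
        lia

theorem sum_Icc_norm_setFourierCoeff_sq_le {E : Set ℝ} (hEm : MeasurableSet E)
    (hE : E ⊆ Set.Icc 0 1) {f : ℝ → ℝ} (hf : Continuous f) (hf0 : ∀ x, 0 ≤ f x) {δ B : ℝ}
    (hB : 0 ≤ B)
    (hloc : ∀ α ∈ E,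
      (∫ β in {β : ℝ | β ∈ E ∧ |(β - α) - (round (β - α) : ℝ)| ≤ δ}, f β) ≤ B)
    {K : ℕ} (hK : 1 / (2 * (K + 1) : ℝ) ≤ δ) :
    ∑ h ∈ Finset.Icc (-(K : ℤ)) K, ‖setFourierCoeff E f h‖ ^ 2 ≤
      48 * (K + 1) * cauchySum * B * ∫ β in Set.Icc 0 1, f β := by
  set N := 2 * (K + 1) with hN
  have hNδ : 1 / (N : ℝ) ≤ δ := by
    rw [hN]
    push_cast
    exact hK
  have hNpos : 0 < N := by lia
  have hint : IntegrableOn f E := hf.integrableOn_Icc.mono_set hE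
  have hC := cauchySum_pos
  have hlower := mul_sum_Icc_le_sum_range_product
    (F := fun h => ‖setFourierCoeff E f h‖ ^ 2) (fun h => by positivity) K
  rw [← hN, sum_norm_setFourierCoeff_sq hE hf N] at hlower
  have hupper : ∫ α in E, f α * ∫ β in E, f β * ‖dirichletSum N (β - α)‖ ^ 2 ≤
      (∫ α in E, f α) * (12 * N ^ 2 * cauchySum * B) := by
    rw [← integral_mul_const]
    refine integral_mono_of_nonneg (ae_of_all _ fun α => mul_nonneg (hf0 α)
      (integral_nonneg fun β => mul_nonneg (hf0 β) (by positivity))) (hint.mul_const _) ?_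
    filter_upwards [ae_restrict_mem hEm] with α hα
    exact mul_le_mul_of_nonneg_left (setIntegral_mul_norm_dirichletSum_sq_le hEm hE hf hf0 hB
      hloc hNpos hNδ (hE hα)) (hf0 α)
  have hmono : ∫ α in E, f α ≤ ∫ α in Set.Icc 0 1, f α :=
    setIntegral_mono_set hf.integrableOn_Icc (ae_of_all _ hf0) hE.eventuallyLE
  have hKpos : (0 : ℝ) < K + 1 := by positivity
  refine le_of_mul_le_mul_left ?_ hKpos
  calc ((K : ℝ) + 1) * ∑ h ∈ Finset.Icc (-(K : ℤ)) K, ‖setFourierCoeff E f h‖ ^ 2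
      ≤ (∫ α in E, f α) * (12 * N ^ 2 * cauchySum * B) := by
        refine le_trans ?_ hupper
        exact_mod_cast hlower
    _ ≤ (∫ α in Set.Icc 0 1, f α) * (12 * N ^ 2 * cauchySum * B) := by gcongr
    _ = _ := by
        rw [hN]
        push_cast
        ring

theorem setIntegral_Icc_e_int_mul (k : ℤ) :
    ∫ β in Set.Icc (0 : ℝ) 1, e (k * β) = if k = 0 then 1 else 0 := by
  rw [integral_Icc_eq_integral_Ioc, ← intervalIntegral.integral_of_le zero_le_one]
  split_ifs with hk
  · simp [hk, e]
  · have hne : 2 * Real.pi * Complex.I * (k : ℂ) ≠ 0 := by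
      simp [Real.pi_ne_zero, hk]
    have h := integral_exp_mul_complex (a := 0) (b := 1) hne
    have h1 := e_int k
    rw [e, Complex.ofReal_intCast] at h1
    have hcongr : ∀ β : ℝ, e (k * β) = Complex.exp (2 * Real.pi * Complex.I * (k : ℂ) * β) := by
      intro β
      rw [e]
      push_cast
      ring_nf
    simp only [hcongr, h]
    simp [h1]

theorem setFourierCoeff_Icc_norm_sq (s : Finset ℕ) (c : ℕ → ℂ) (h : ℤ) :
    setFourierCoeff (Set.Icc 0 1) (fun β => ‖∑ n ∈ s, c n * e (n * β)‖ ^ 2) h =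
      ∑ p ∈ s ×ˢ s, if (p.1 : ℤ) - (p.2 : ℤ) = h
        then c p.1 * (starRingEnd ℂ) (c p.2) else 0 := by
  have hexpand : ∀ β : ℝ, ((‖∑ n ∈ s, c n * e (n * β)‖ ^ 2 : ℝ) : ℂ) * e (-(h * β)) =
      ∑ p ∈ s ×ˢ s, c p.1 * (starRingEnd ℂ) (c p.2) * e (((p.1 : ℤ) - p.2 - h : ℤ) * β) := by
    intro β
    rw [← Complex.normSq_eq_norm_sq, ← Complex.mul_conj, map_sum, Finset.sum_mul_sum,
      ← Finset.sum_product', Finset.sum_mul]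
    refine Finset.sum_congr rfl fun p _ => ?_
    rw [map_mul, conj_e, mul_mul_mul_comm, ← e_add, mul_assoc, ← e_add]
    push_cast
    ring_nf
  simp only [setFourierCoeff, hexpand]
  rw [integral_finsetSum _ fun p _ => Continuous.integrableOn_Icc (by fun_prop)]
  refine Finset.sum_congr rfl fun p _ => ?_
  rw [integral_const_mul, setIntegral_Icc_e_int_mul]
  simp [sub_eq_zero]

theorem setIntegral_Icc_norm_sq (s : Finset ℕ) (c : ℕ → ℂ) :
    ∫ β in Set.Icc 0 1, ‖∑ n ∈ s, c n * e (n * β)‖ ^ 2 = ∑ n ∈ s, ‖c n‖ ^ 2 := by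
  have h := setFourierCoeff_Icc_norm_sq s c 0
  apply Complex.ofReal_injective
  rw [← integral_complex_ofReal]
  simp only [setFourierCoeff, Int.cast_zero, zero_mul, neg_zero] at h
  have he0 : e 0 = 1 := by simpa using e_int 0
  simp only [he0, mul_one] at h
  rw [h, Finset.sum_product]
  push_cast
  refine Finset.sum_congr rfl fun n hn => ?_
  simp [sub_eq_zero, hn, Complex.mul_conj, Complex.normSq_eq_norm_sq]

theorem setFourierCoeff_add_diff {E F : Set ℝ} (hEm : MeasurableSet E) (hFm : MeasurableSet F)
    (hEF : E ⊆ F) {f : ℝ → ℝ} {h : ℤ}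
    (hf : IntegrableOn (fun β => (f β : ℂ) * e (-(h * β))) F) :
    setFourierCoeff F f h = setFourierCoeff E f h + setFourierCoeff (F \ E) f h := by
  simp only [setFourierCoeff]
  rw [← setIntegral_union Set.disjoint_sdiff_right (hFm.diff hEm) (hf.mono_set hEF)
    (hf.mono_set Set.sdiff_subset), Set.union_sdiff_cancel hEF]

/-- The circle-method skeleton of the proofs of Theorems 1.1 and 1.2: there is an
absolute constant `C > 0` such that for every `H ≥ 1`, every finitely supported
`c : ℕ → ℂ` (with `c 0 = 0`), writing `S_c(α) = ∑_{n≥1} c(n) e(nα)`, every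
measurable `M ⊆ [0,1]` with complement `m = [0,1] \ M`, and all `B₁, B₂ ≥ 0` with
`∫_{β ∈ M, ‖β-α‖ ≤ 1/(2H)} |S_c(β)|² dβ ≤ B₁` for all `α ∈ M` and
`∫_{β ∈ m, ‖β-α‖ ≤ 1/(2H)} |S_c(β)|² dβ ≤ B₂` for all `α ∈ m` (here `‖t‖` is the
distance from `t` to the nearest integer), one has
`∑_{1≤|h|≤H} |∑_{n-m'=h} c(n) conj(c(m'))|² ≤ C H (∑_n |c(n)|²) (B₁ + B₂)`. -/
theorem stmt_12 :
    ∃ C : ℝ, 0 < C ∧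
      ∀ (H : ℝ), 1 ≤ H → ∀ c : ℕ → ℂ, (Function.support c).Finite → c 0 = 0 →
        ∀ M : Set ℝ, MeasurableSet M → M ⊆ Set.Icc 0 1 →
        ∀ B₁ B₂ : ℝ, 0 ≤ B₁ → 0 ≤ B₂ →
        (∀ α ∈ M,
          (∫ β in {β : ℝ | β ∈ M ∧ |(β - α) - (round (β - α) : ℝ)| ≤ 1 / (2 * H)},
              ‖∑' n : ℕ, c n * e ((n : ℝ) * β)‖ ^ 2) ≤ B₁) →
        (∀ α ∈ Set.Icc (0 : ℝ) 1 \ M,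
          (∫ β in {β : ℝ | β ∈ Set.Icc (0 : ℝ) 1 \ M ∧
                |(β - α) - (round (β - α) : ℝ)| ≤ 1 / (2 * H)},
              ‖∑' n : ℕ, c n * e ((n : ℝ) * β)‖ ^ 2) ≤ B₂) →
        (∑' h : ℤ, if 1 ≤ |(h : ℝ)| ∧ |(h : ℝ)| ≤ H then
            ‖∑' p : ℕ × ℕ, if (p.1 : ℤ) - (p.2 : ℤ) = h
                then c p.1 * (starRingEnd ℂ) (c p.2) else 0‖ ^ 2
          else 0)
          ≤ C * H * (∑' n : ℕ, ‖c n‖ ^ 2) * (B₁ + B₂) := by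
  have hC := cauchySum_pos
  refine ⟨192 * cauchySum, by positivity, ?_⟩
  intro H hH c hc hc0 M hMm hM B₁ B₂ hB₁ hB₂ h₁ h₂
  set s : Finset ℕ := hc.toFinset
  have hcs : ∀ n ∉ s, c n = 0 := fun n hn => by simpa [s] using hn
  have hS : ∀ β : ℝ, ∑' n : ℕ, c n * e ((n : ℝ) * β) = ∑ n ∈ s, c n * e (n * β) := fun β =>
    tsum_eq_sum fun n hn => by rw [hcs n hn, zero_mul]
  have hL2 : ∑' n : ℕ, ‖c n‖ ^ 2 = ∑ n ∈ s, ‖c n‖ ^ 2 :=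
    tsum_eq_sum fun n hn => by simp [hcs n hn]
  simp only [hS] at h₁ h₂
  set f : ℝ → ℝ := fun β => ‖∑ n ∈ s, c n * e (n * β)‖ ^ 2
  have hf : Continuous f := by fun_prop
  have hf0 : ∀ β, 0 ≤ f β := fun β => by positivity
  have hcorr : ∀ h : ℤ, (∑' p : ℕ × ℕ, if (p.1 : ℤ) - (p.2 : ℤ) = h
      then c p.1 * (starRingEnd ℂ) (c p.2) else 0) = setFourierCoeff (Set.Icc 0 1) f h := by
    intro h
    rw [setFourierCoeff_Icc_norm_sq]
    refine tsum_eq_sum fun p hp => ?_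
    rw [Finset.mem_product, not_and_or] at hp
    rcases hp with hp | hp <;> simp [hcs _ hp]
  set K := ⌊H⌋₊
  have hKH : (K : ℝ) ≤ H := Nat.floor_le (by linarith)
  have hHK : H < K + 1 := Nat.lt_floor_add_one H
  have hK : 1 / (2 * (K + 1) : ℝ) ≤ 1 / (2 * H) := by gcongr
  have hsupp : ∀ h ∉ Finset.Icc (-(K : ℤ)) K, ¬ (1 ≤ |(h : ℝ)| ∧ |(h : ℝ)| ≤ H) := by
    rintro h hh ⟨-, hle⟩
    refine hh (Finset.mem_Icc.2 (abs_le.1 ?_))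
    have : ((|h| : ℤ) : ℝ) < ((K + 1 : ℤ) : ℝ) := by push_cast; linarith
    have := Int.cast_lt.1 this
    lia
  have hbound₁ := sum_Icc_norm_setFourierCoeff_sq_le hMm hM hf hf0 hB₁ h₁ hK
  have hbound₂ := sum_Icc_norm_setFourierCoeff_sq_le (measurableSet_Icc.diff hMm)
    Set.sdiff_subset hf hf0 hB₂ h₂ hK
  have hsplit : ∀ h : ℤ, ‖setFourierCoeff (Set.Icc 0 1) f h‖ ^ 2 ≤
      2 * (‖setFourierCoeff M f h‖ ^ 2 + ‖setFourierCoeff (Set.Icc 0 1 \ M) f h‖ ^ 2) := by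
    intro h
    rw [setFourierCoeff_add_diff hMm measurableSet_Icc hM
      (Continuous.integrableOn_Icc (by fun_prop))]
    exact (pow_le_pow_left₀ (norm_nonneg _) (norm_add_le _ _) 2).trans add_sq_le
  rw [setIntegral_Icc_norm_sq, ← hL2] at hbound₁ hbound₂
  have hA : 0 ≤ ∑' n : ℕ, ‖c n‖ ^ 2 := tsum_nonneg fun _ => by positivity
  simp only [hcorr]
  rw [tsum_eq_sum fun h hh => if_neg (hsupp h hh)]
  calc _ ≤ ∑ h ∈ Finset.Icc (-(K : ℤ)) K, 2 * (‖setFourierCoeff M f h‖ ^ 2 +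
          ‖setFourierCoeff (Set.Icc 0 1 \ M) f h‖ ^ 2) := by
        refine Finset.sum_le_sum fun h _ => ?_
        split_ifs
        · exact hsplit h
        · positivity
    _ = 2 * (∑ h ∈ Finset.Icc (-(K : ℤ)) K, ‖setFourierCoeff M f h‖ ^ 2 +
          ∑ h ∈ Finset.Icc (-(K : ℤ)) K, ‖setFourierCoeff (Set.Icc 0 1 \ M) f h‖ ^ 2) := by
        rw [← Finset.mul_sum, Finset.sum_add_distrib]
    _ ≤ 2 * (48 * (K + 1) * cauchySum * B₁ * (∑' n : ℕ, ‖c n‖ ^ 2) +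
          48 * (K + 1) * cauchySum * B₂ * (∑' n : ℕ, ‖c n‖ ^ 2)) := by gcongr
    _ = 96 * cauchySum * (K + 1) * (∑' n : ℕ, ‖c n‖ ^ 2) * (B₁ + B₂) := by ring
    _ ≤ 96 * cauchySum * (2 * H) * (∑' n : ℕ, ‖c n‖ ^ 2) * (B₁ + B₂) := by
        gcongr
        linarith
    _ = _ := by ring
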